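/- arXiv:1506.01590 — 2 statements merged into one kernel-verified Lean document; each statement's English description precedes it below -/
import Mathlib

section
/- Suppose r ∈ (-1,1], ν is a probability distribution on ℤ with ν(-2) > 0, and h_r^{(0)} is ν-harmonic on ℤ_{>0}. Then for every integer l ≥ 1, the random walk (X_i) started at X_0 = l hits zero before hitting the negative integers with probability h_r^{(0)}(l); that is, letting τ = inf{ i ≥ 0 : X_i ≤ 0 }, one has P(τ < ∞ and X_τ = 0) = h_r^{(0)}(l). -/
open scoped BigOperators

noncomputable def h0 (r : ℝ) (l : ℤ) : ℝ :=
  if 0 ≤ l then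
    (4 : ℝ) ^ (-l) *
      ∑ m ∈ Finset.range (l.toNat + 1),
        (Nat.choose (2 * m) m : ℝ) * (Nat.choose (2 * (l.toNat - m)) (l.toNat - m) : ℝ) *
          (-r) ^ (l.toNat - m)
  else 0

noncomputable def h1 (r : ℝ) (l : ℤ) : ℝ :=
  if 1 ≤ l then ∑ p ∈ Finset.range l.toNat, h0 r (p : ℤ) else 0

noncomputable def h2 (r : ℝ) (l : ℤ) : ℝ :=
  if 2 ≤ l then ∑ p ∈ Finset.Icc 1 (l.toNat - 1), h1 r (p : ℤ) else 0

noncomputable def hm1 (r : ℝ) (l : ℤ) : ℝ := h0 r (l + 1) - h0 r l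

noncomputable def hm2 (r : ℝ) (l : ℤ) : ℝ := hm1 r (l + 1) - hm1 r l

noncomputable def kernelR (r : ℝ) (k m : ℤ) : ℝ :=
  ∑ p ∈ Finset.range m.toNat,
    h1 r (m - (p : ℤ)) * (hm2 r (k + (p : ℤ) - 1) + r * hm2 r (k + (p : ℤ) - 2))

/-- `ν` is a probability distribution on `ℤ`. -/
def IsProbDist (ν : ℤ → ℝ) : Prop := (∀ k, 0 ≤ ν k) ∧ HasSum ν 1

/-- A nonnegative function `f : ℤ → [0,∞)` is `ν`-harmonic on `ℤ_{>0}`. -/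
def NuHarmonic (ν : ℤ → ℝ) (f : ℤ → ℝ) : Prop :=
  (∀ l, 0 ≤ f l) ∧ ∀ k : ℤ, 1 ≤ k → HasSum (fun l : ℤ => f (k + l) * ν l) (f k)

noncomputable def Lnu (r : ℝ) (ν : ℤ → ℝ) : ℝ :=
  ∑' k : ℕ, ν ((k : ℤ) + 1) * h2 r ((k : ℤ) + 2)

noncomputable def phiNu (ν : ℤ → ℝ) (θ : ℝ) : ℂ :=
  ∑' k : ℤ, (ν k : ℂ) * Complex.exp (Complex.I * (k : ℂ) * (θ : ℂ))

open MeasureTheory ProbabilityTheory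

/-- The normalised central binomial coefficient `4⁻ᵐ * (2m choose m)`. -/
noncomputable def centralWeight (m : ℕ) : ℝ := (Nat.choose (2 * m) m : ℝ) / 4 ^ m

lemma centralWeight_zero : centralWeight 0 = 1 := by simp [centralWeight]

lemma centralWeight_nonneg (m : ℕ) : 0 ≤ centralWeight m := by
  unfold centralWeight; positivity

lemma centralWeight_succ (m : ℕ) :
    (2 * m + 2) * centralWeight (m + 1) = (2 * m + 1) * centralWeight m := by
  have h := Nat.succ_mul_centralBinom_succ m
  simp only [Nat.centralBinom_eq_two_mul_choose] at h
  have h' : ((m : ℝ) + 1) * (Nat.choose (2 * (m + 1)) (m + 1) : ℝ)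
      = 2 * (2 * m + 1) * (Nat.choose (2 * m) m : ℝ) := by exact_mod_cast h
  unfold centralWeight
  rw [pow_succ]
  field_simp
  linear_combination 2 * h'

lemma centralWeight_sq_le (m : ℕ) : centralWeight m ^ 2 * (2 * m + 1) ≤ 1 := by
  induction m with
  | zero => simp [centralWeight_zero]
  | succ m ih =>
    have h := centralWeight_succ m
    have hm : (0 : ℝ) ≤ m := m.cast_nonneg
    have e : centralWeight (m + 1) ^ 2 * (2 * m + 2) ^ 2
        = (centralWeight m ^ 2 * (2 * m + 1)) * (2 * m + 1) := by
      linear_combination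
        ((2 * m + 2) * centralWeight (m + 1) + (2 * m + 1) * centralWeight m) * h
    have e' : centralWeight (m + 1) ^ 2 * (2 * m + 2) ^ 2 ≤ 2 * m + 1 := by
      rw [e]; nlinarith
    push_cast
    have hs := sq_nonneg (centralWeight (m + 1))
    have : centralWeight (m + 1) ^ 2 * (2 * (m + 1) + 1) * (2 * m + 2) ^ 2
        ≤ 1 * (2 * (m : ℝ) + 2) ^ 2 := by nlinarith
    exact le_of_mul_le_mul_right this (by positivity)

lemma centralWeight_le_one (m : ℕ) : centralWeight m ≤ 1 := by
  have h := centralWeight_sq_le m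
  have hm : (0 : ℝ) ≤ m := m.cast_nonneg
  have h0 := centralWeight_nonneg m
  nlinarith [sq_nonneg (centralWeight m), mul_nonneg (sq_nonneg (centralWeight m)) hm]

lemma tendsto_centralWeight :
    Filter.Tendsto centralWeight Filter.atTop (nhds 0) := by
  have h2 : Filter.Tendsto (fun m => centralWeight m ^ 2) Filter.atTop (nhds 0) := by
    refine squeeze_zero (fun m => sq_nonneg _) (fun m => ?_)
      (tendsto_one_div_add_atTop_nhds_zero_nat (𝕜 := ℝ))
    have h := centralWeight_sq_le m
    have hm : (0 : ℝ) ≤ m := m.cast_nonneg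
    rw [le_div_iff₀ (by positivity)]
    nlinarith [mul_nonneg (sq_nonneg (centralWeight m)) hm]
  have h3 := (Real.continuous_sqrt.tendsto 0).comp h2
  simpa [Function.comp_def, Real.sqrt_sq (centralWeight_nonneg _)] using h3

lemma h0_natCast (r : ℝ) (n : ℕ) :
    h0 r n = ∑ p ∈ Finset.HasAntidiagonal.antidiagonal n,
      centralWeight p.1 * (centralWeight p.2 * (-r) ^ p.2) := by
  rw [Finset.Nat.sum_antidiagonal_eq_sum_range_succ
    (fun i j => centralWeight i * (centralWeight j * (-r) ^ j)), h0, if_pos (by positivity),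
    Finset.mul_sum]
  refine Finset.sum_congr (by simp) fun m hm => ?_
  have hmn : m ≤ n := by simpa [Nat.lt_succ_iff] using hm
  have h4 : (4 : ℝ) ^ n = 4 ^ m * 4 ^ (n - m) := by rw [← pow_add]; congr 1; omega
  simp only [centralWeight, Int.toNat_natCast, zpow_neg, zpow_natCast, h4]
  field_simp

/-- The convolution of a null sequence with a summable one tends to zero. -/
lemma tendsto_convolution_zero {a b : ℕ → ℝ} (ha : Filter.Tendsto a Filter.atTop (nhds 0))
    (ha1 : ∀ n, |a n| ≤ 1) (hb : Summable fun n => |b n|) :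
    Filter.Tendsto (fun n => ∑ p ∈ Finset.HasAntidiagonal.antidiagonal n, a p.1 * b p.2)
      Filter.atTop (nhds 0) := by
  have key := tendsto_tsum_of_dominated_convergence (𝓕 := Filter.atTop)
    (f := fun n j => if j ∈ Finset.range (n + 1) then a (n - j) * b j else 0)
    (g := fun _ => (0 : ℝ)) hb ?_ ?_
  · simp only [tsum_zero] at key
    refine key.congr fun n => ?_
    rw [← Finset.Nat.sum_antidiagonal_swap]
    simp only [Prod.fst_swap, Prod.snd_swap]
    rw [Finset.Nat.sum_antidiagonal_eq_sum_range_succ (fun i j => a j * b i),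
      tsum_eq_sum (s := Finset.range (n + 1)) (fun j hj => if_neg hj)]
    exact Finset.sum_congr rfl fun j hj => if_pos hj
  · intro j
    have h1 := (ha.comp (Filter.tendsto_sub_atTop_nat j)).mul_const (b j)
    rw [zero_mul] at h1
    refine h1.congr' ?_
    filter_upwards [Filter.eventually_ge_atTop j] with n hn
    simp [hn]
  · refine Filter.Eventually.of_forall fun n j => ?_
    split_ifs
    · rw [Real.norm_eq_abs, abs_mul]
      exact mul_le_of_le_one_left (abs_nonneg _) (ha1 _)
    · simp

lemma summable_centralWeight_mul_pow {r : ℝ} (hr : |r| < 1) :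
    Summable fun n => |centralWeight n * (-r) ^ n| := by
  refine Summable.of_nonneg_of_le (fun n => abs_nonneg _) (fun n => ?_)
    (summable_geometric_of_lt_one (abs_nonneg r) hr)
  rw [abs_mul, abs_pow, abs_neg, abs_of_nonneg (centralWeight_nonneg n)]
  exact mul_le_of_le_one_left (by positivity) (centralWeight_le_one n)

/-- The generating function of `h0 1` satisfies `(1 - X²) F' = X F`; on coefficients. -/
lemma h0_one_add_two (n : ℕ) :
    ((n : ℝ) + 2) * h0 1 ((n + 2 : ℕ) : ℤ) = (n + 1) * h0 1 (n : ℤ) := by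
  let A : PowerSeries ℝ := PowerSeries.mk centralWeight
  let B : PowerSeries ℝ := PowerSeries.mk fun n => centralWeight n * (-1) ^ n
  have hF (n : ℕ) : PowerSeries.coeff n (A * B) = h0 1 (n : ℤ) := by
    simp [A, B, PowerSeries.coeff_mul, h0_natCast]
  have hA : 2 * (1 - PowerSeries.X) * PowerSeries.derivative ℝ A = A := by
    rw [show 2 * (1 - PowerSeries.X) * PowerSeries.derivative ℝ A =
        PowerSeries.C 2 * PowerSeries.derivative ℝ A -
          PowerSeries.C 2 * (PowerSeries.X * PowerSeries.derivative ℝ A) by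
      rw [map_ofNat]; ring]
    ext n
    have h := centralWeight_succ n
    cases n with
    | zero =>
      rw [map_sub, PowerSeries.coeff_C_mul, PowerSeries.coeff_C_mul, PowerSeries.coeff_zero_X_mul,
        PowerSeries.coeff_derivative]
      simp [A] at h ⊢
      linear_combination h
    | succ n =>
      simp [A, PowerSeries.coeff_derivative, PowerSeries.coeff_succ_X_mul] at h ⊢
      linear_combination h
  have hB : 2 * (1 + PowerSeries.X) * PowerSeries.derivative ℝ B = -B := by
    rw [show 2 * (1 + PowerSeries.X) * PowerSeries.derivative ℝ B =
        PowerSeries.C 2 * PowerSeries.derivative ℝ B +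
          PowerSeries.C 2 * (PowerSeries.X * PowerSeries.derivative ℝ B) by
      rw [map_ofNat]; ring]
    ext n
    have h := centralWeight_succ n
    cases n with
    | zero =>
      rw [map_add, PowerSeries.coeff_C_mul, PowerSeries.coeff_C_mul, PowerSeries.coeff_zero_X_mul,
        PowerSeries.coeff_derivative]
      simp [B] at h ⊢
      linear_combination h
    | succ n =>
      simp [B, PowerSeries.coeff_derivative, PowerSeries.coeff_succ_X_mul] at h ⊢
      linear_combination (-1) ^ n * h
  have hAB : (1 - PowerSeries.X ^ 2) * PowerSeries.derivative ℝ (A * B)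
      = PowerSeries.X * (A * B) := by
    have h2 : PowerSeries.C (2 : ℝ) ≠ 0 := by simp
    apply mul_left_cancel₀ h2
    rw [map_ofNat]
    rw [Derivation.leibniz]
    simp only [smul_eq_mul]
    linear_combination (1 + PowerSeries.X) * B * hA + (1 - PowerSeries.X) * A * hB
  have hc := congrArg (PowerSeries.coeff (n + 1)) hAB
  rw [sub_mul, one_mul, pow_two, mul_assoc, map_sub, PowerSeries.coeff_succ_X_mul,
    PowerSeries.coeff_succ_X_mul, PowerSeries.coeff_derivative, hF, hF] at hc
  cases n with
  | zero =>
    simp at hc ⊢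
    linear_combination hc
  | succ n =>
    rw [PowerSeries.coeff_succ_X_mul, PowerSeries.coeff_derivative, hF] at hc
    rw [show ((n + 1 + 2 : ℕ) : ℤ) = ((n + 1 + 1 + 1 : ℕ) : ℤ) by rfl]
    push_cast at hc ⊢
    linear_combination hc

lemma h0_one_even (k : ℕ) : h0 1 ((2 * k : ℕ) : ℤ) = centralWeight k := by
  induction k with
  | zero => simp [h0, centralWeight]
  | succ k ih =>
    have h := h0_one_add_two (2 * k)
    have h' := centralWeight_succ k
    rw [ih] at h
    push_cast at h h' ⊢
    have : (2 * (k : ℝ) + 2) ≠ 0 := by positivity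
    apply mul_left_cancel₀ this
    rw [h', ← h]
    congr 2

lemma h0_one_odd (k : ℕ) : h0 1 ((2 * k + 1 : ℕ) : ℤ) = 0 := by
  induction k with
  | zero => norm_num [h0, Finset.sum_range_succ]
  | succ k ih =>
    have h := h0_one_add_two (2 * k + 1)
    rw [ih, mul_zero] at h
    exact (mul_eq_zero.1 h).resolve_left (by positivity)

lemma tendsto_h0 {r : ℝ} (hr : r ∈ Set.Ioc (-1 : ℝ) 1) :
    Filter.Tendsto (fun n : ℕ => h0 r n) Filter.atTop (nhds 0) := by
  rcases eq_or_lt_of_le hr.2 with rfl | h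
  · have hdiv : Filter.Tendsto (fun n : ℕ => n / 2) Filter.atTop Filter.atTop :=
      Nat.tendsto_div_const_atTop two_ne_zero
    refine squeeze_zero_norm (fun n => ?_) (tendsto_centralWeight.comp hdiv)
    rcases Nat.even_or_odd' n with ⟨k, rfl | rfl⟩
    · rw [h0_one_even, Real.norm_of_nonneg (centralWeight_nonneg k)]
      simp
    · rw [h0_one_odd, norm_zero]
      exact centralWeight_nonneg _
  · simp only [h0_natCast]
    exact tendsto_convolution_zero (b := fun j => centralWeight j * (-r) ^ j)
      tendsto_centralWeight
      (fun n => by rw [abs_of_nonneg (centralWeight_nonneg n)]; exact centralWeight_le_one n)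
      (summable_centralWeight_mul_pow (abs_lt.2 ⟨hr.1, h⟩))

lemma h0_zero (r : ℝ) : h0 r 0 = 1 := by simp [h0]

lemma h0_of_neg (r : ℝ) {k : ℤ} (hk : k < 0) : h0 r k = 0 := by simp [h0, not_le.2 hk]

/-- The walk started at `l` with increments `Y` stays positive before time `n` and is at `k` at
time `n`. -/
def positiveUntil {Ω : Type*} (Y : ℕ → Ω → ℤ) (l : ℤ) (n : ℕ) (k : ℤ) : Set Ω :=
  {ω | (∀ j < n, 0 < l + ∑ m ∈ Finset.range j, Y m ω) ∧
    l + ∑ m ∈ Finset.range n, Y m ω = k}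

lemma disjoint_positiveUntil_of_nonpos {Ω : Type*} {Y : ℕ → Ω → ℤ} {l : ℤ} {k : ℤ} (hk : k ≤ 0) :
    Pairwise (Function.onFun Disjoint fun n => positiveUntil Y l n k) := by
  have key {i j : ℕ} (hij : i < j) :
      Disjoint (positiveUntil Y l i k) (positiveUntil Y l j k) :=
    Set.disjoint_left.2 fun ω hi hj => absurd (hj.1 i hij) (by rw [hi.2]; omega)
  intro i j hij
  rcases lt_or_gt_of_ne hij with h | h
  exacts [key h, (key h).symm]

section Walk

variable {Ω : Type*} [MeasurableSpace Ω] {μ : Measure Ω} {Y : ℕ → Ω → ℤ} {l : ℤ}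

lemma measurableSet_positiveUntil (hmeas : ∀ j, Measurable (Y j)) (n : ℕ) (k : ℤ) :
    MeasurableSet (positiveUntil Y l n k) := by
  have hS (j : ℕ) : Measurable fun ω => l + ∑ m ∈ Finset.range j, Y m ω :=
    measurable_const.add (Finset.measurable_sum _ fun m _ => hmeas m)
  have hset : positiveUntil Y l n k =
      (⋂ j, ⋂ (_ : j < n), (fun ω => l + ∑ m ∈ Finset.range j, Y m ω) ⁻¹' Set.Ioi 0) ∩
        (fun ω => l + ∑ m ∈ Finset.range n, Y m ω) ⁻¹' {k} := by
    ext; simp [positiveUntil]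
  rw [hset]
  exact (MeasurableSet.iInter fun j => .iInter fun _ => hS j measurableSet_Ioi).inter
    (hS n (measurableSet_singleton k))

lemma measure_positiveUntil_inter (hindep : iIndepFun Y μ) (hmeas : ∀ j, Measurable (Y j))
    (n : ℕ) (k d : ℤ) :
    μ (positiveUntil Y l n k ∩ Y n ⁻¹' {d}) =
      μ (positiveUntil Y l n k) * μ (Y n ⁻¹' {d}) := by
  have hI := hindep.indepFun_finset (Finset.range n) {n} (by simp) hmeas
  let e (f : Finset.range n → ℤ) (m : ℕ) : ℤ := if h : m ∈ Finset.range n then f ⟨m, h⟩ else 0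
  let T : Set (Finset.range n → ℤ) := {f | (∀ j < n, 0 < l + ∑ m ∈ Finset.range j, e f m) ∧
    l + ∑ m ∈ Finset.range n, e f m = k}
  let U : Set (({n} : Finset ℕ) → ℤ) := {g | g ⟨n, by simp⟩ = d}
  have hT : positiveUntil Y l n k = (fun ω (i : Finset.range n) => Y i ω) ⁻¹' T := by
    have hs (ω : Ω) (j : ℕ) (hj : j ≤ n) :
        ∑ m ∈ Finset.range j, e (fun i : Finset.range n => Y i ω) m =
          ∑ m ∈ Finset.range j, Y m ω :=
      Finset.sum_congr rfl fun m hm => by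
        have : m < n := (Finset.mem_range.1 hm).trans_le hj
        simp [e, this]
    ext ω
    simp only [positiveUntil, T, Set.mem_preimage, Set.mem_ofPred_eq, hs ω n le_rfl]
    refine and_congr_left fun _ => forall₂_congr fun j hj => ?_
    rw [hs ω j hj.le]
  have hU : Y n ⁻¹' {d} = (fun ω (i : ({n} : Finset ℕ)) => Y i ω) ⁻¹' U := by
    ext ω; simp [U]
  rw [hT, hU]
  exact hI.measure_inter_preimage_eq_mul T U (.of_discrete) (.of_discrete)

lemma measure_positiveUntil_succ {N : ℤ → ENNReal} (hindep : iIndepFun Y μ)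
    (hmeas : ∀ j, Measurable (Y j)) (hlaw : ∀ j k, μ (Y j ⁻¹' {k}) = N k) (n : ℕ) (k : ℤ) :
    μ (positiveUntil Y l (n + 1) k) =
      ∑' i : ℤ, if 0 < i then μ (positiveUntil Y l n i) * N (k - i) else 0 := by
  have hset : positiveUntil Y l (n + 1) k =
      ⋃ i : ℤ, if 0 < i then positiveUntil Y l n i ∩ Y n ⁻¹' {k - i} else ∅ := by
    ext ω
    simp only [Set.mem_iUnion]
    constructor
    · rintro ⟨h1, h2⟩
      refine ⟨l + ∑ m ∈ Finset.range n, Y m ω, ?_⟩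
      rw [if_pos (h1 n n.lt_succ_self)]
      refine ⟨⟨fun j hj => h1 j (by omega), rfl⟩, ?_⟩
      rw [Finset.sum_range_succ] at h2
      simp only [Set.mem_preimage, Set.mem_singleton_iff]
      omega
    · rintro ⟨i, hi⟩
      split_ifs at hi with h0
      · obtain ⟨⟨h1, h2⟩, h3⟩ := hi
        simp only [Set.mem_preimage, Set.mem_singleton_iff] at h3
        refine ⟨fun j hj => ?_, by rw [Finset.sum_range_succ]; omega⟩
        rcases Nat.lt_succ_iff_lt_or_eq.1 hj with h | rfl
        exacts [h1 j h, h2 ▸ h0]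
      · exact hi.elim
  rw [hset, measure_iUnion]
  · refine tsum_congr fun i => ?_
    split_ifs
    · rw [measure_positiveUntil_inter hindep hmeas, hlaw]
    · simp
  · intro i j hij
    refine Set.disjoint_left.2 fun ω hi hj => hij ?_
    dsimp only at hi hj
    split_ifs at hi hj
    · exact hi.1.2.symm.trans hj.1.2
    all_goals simp_all
  · intro i
    split_ifs
    · exact (measurableSet_positiveUntil hmeas n i).inter (hmeas n (measurableSet_singleton _))
    · exact .empty

/-- If the increment `-2` has positive probability, then the expected number of visits to any
given state up to the exit from the positive integers is finite. -/
lemma tsum_measure_positiveUntil_ne_top [IsFiniteMeasure μ] {N : ℤ → ENNReal}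
    (hN2 : N (-2) ≠ 0) (hindep : iIndepFun Y μ) (hmeas : ∀ j, Measurable (Y j))
    (hlaw : ∀ j k, μ (Y j ⁻¹' {k}) = N k) (k : ℕ) :
    ∑' n, μ (positiveUntil Y l n k) ≠ ⊤ := by
  have hnonpos {k : ℤ} (hk : k ≤ 0) : ∑' n, μ (positiveUntil Y l n k) ≠ ⊤ := by
    rw [← measure_iUnion (disjoint_positiveUntil_of_nonpos hk)
      fun n => measurableSet_positiveUntil hmeas n k]
    exact measure_ne_top _ _
  have hstep {k : ℤ} (hk : 0 < k) (h : ∑' n, μ (positiveUntil Y l n (k - 2)) ≠ ⊤) :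
      ∑' n, μ (positiveUntil Y l n k) ≠ ⊤ := by
    have hle : (∑' n, μ (positiveUntil Y l n k)) * N (-2) ≤
        ∑' n, μ (positiveUntil Y l n (k - 2)) := by
      rw [← ENNReal.tsum_mul_right]
      calc _ ≤ ∑' n, μ (positiveUntil Y l (n + 1) (k - 2)) := by
            refine ENNReal.tsum_le_tsum fun n => ?_
            rw [measure_positiveUntil_succ hindep hmeas hlaw]
            refine le_trans (le_of_eq ?_) (ENNReal.le_tsum k)
            rw [if_pos hk]; congr 2; omega
        _ ≤ _ := ENNReal.tsum_comp_le_tsum_of_injective (add_left_injective 1)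
            fun n => μ (positiveUntil Y l n (k - 2))
    intro htop
    rw [htop, ENNReal.top_mul hN2, top_le_iff] at hle
    exact h hle
  induction k using Nat.strong_induction_on with
  | _ k ih =>
    rcases Nat.eq_zero_or_pos k with rfl | hk
    · exact hnonpos (by simp)
    · refine hstep (by exact_mod_cast hk) ?_
      rcases le_or_gt 2 k with h2 | h2
      · have := ih (k - 2) (by omega)
        rwa [Nat.cast_sub h2] at this
      · exact hnonpos (by omega)

lemma tsum_measure_positiveUntil_le (hmeas : ∀ j, Measurable (Y j)) (n : ℕ) :
    ∑' k, μ (positiveUntil Y l n k) ≤ μ Set.univ := by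
  rw [← measure_iUnion _ fun k => measurableSet_positiveUntil hmeas n k]
  · exact measure_mono (Set.subset_univ _)
  · intro i j hij
    exact Set.disjoint_left.2 fun ω hi hj => hij (hi.2.symm.trans hj.2)

end Walk

/-- If subprobability weights on `ℤ` become negligible at each nonnegative point, then their
pairing over the positive integers with a finite function vanishing at infinity tends to zero. -/
lemma tendsto_tsum_pos_mul {q : ℕ → ℤ → ENNReal} {H : ℤ → ENNReal}
    (hq1 : ∀ n, ∑' k, q n k ≤ 1)
    (hq : ∀ k : ℕ, Filter.Tendsto (fun n => q n k) Filter.atTop (nhds 0))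
    (hHtop : ∀ k, H k ≠ ⊤)
    (hH : Filter.Tendsto (fun k : ℕ => H k) Filter.atTop (nhds 0)) :
    Filter.Tendsto (fun n => ∑' k : ℤ, if 0 < k then q n k * H k else 0)
      Filter.atTop (nhds 0) := by
  rw [ENNReal.tendsto_nhds_zero]
  intro ε hε
  have hε2 : 0 < ε / 2 := ENNReal.half_pos hε.ne'
  obtain ⟨K, hK⟩ := Filter.eventually_atTop.1 ((ENNReal.tendsto_nhds_zero.1 hH) _ hε2)
  have hsum : Filter.Tendsto (fun n => ∑ k ∈ Finset.range K, q n k * H k)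
      Filter.atTop (nhds 0) := by
    have : Filter.Tendsto (fun n => ∑ k ∈ Finset.range K, q n k * H k)
        Filter.atTop (nhds (∑ k ∈ Finset.range K, 0 * H k)) :=
      tendsto_finsetSum _ fun k _ => ENNReal.Tendsto.mul_const (hq k) (Or.inr (hHtop _))
    simpa using this
  filter_upwards [(ENNReal.tendsto_nhds_zero.1 hsum) _ hε2] with n hn
  have hfin : ∑' k : ℤ, (if 0 < k ∧ k < K then q n k * H k else 0) ≤
      ∑ k ∈ Finset.range K, q n k * H k := by
    rw [tsum_eq_sum (s := (Finset.range K).map Nat.castEmbedding)]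
    · rw [Finset.sum_map]
      refine Finset.sum_le_sum fun k _ => ?_
      simp only [Nat.castEmbedding_apply]
      split_ifs <;> simp
    · intro k hk
      refine if_neg fun h => hk ?_
      simp only [Finset.mem_map, Finset.mem_range, Nat.castEmbedding_apply]
      exact ⟨k.toNat, by omega, by simpa using h.1.le⟩
  calc _ ≤ ∑' k : ℤ, ((if 0 < k ∧ k < K then q n k * H k else 0) + q n k * (ε / 2)) := by
        refine ENNReal.tsum_le_tsum fun k => ?_
        by_cases hk : 0 < k
        · by_cases hkK : k < K
          · simp [hk, hkK]
          · have : H k ≤ ε / 2 := by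
              have := hK k.toNat (by omega)
              rwa [Int.toNat_of_nonneg hk.le] at this
            simp only [hk, hkK, if_true, and_false, if_false, zero_add]
            gcongr
        · simp [hk]
    _ = ∑' k : ℤ, (if 0 < k ∧ k < K then q n k * H k else 0) + (∑' k, q n k) * (ε / 2) := by
        rw [ENNReal.tsum_add, ENNReal.tsum_mul_right]
    _ ≤ ε / 2 + 1 * (ε / 2) := by
        gcongr
        exacts [hfin.trans hn, hq1 n]
    _ = ε := by rw [one_mul, ENNReal.add_halves]

/-- the walk started at `l ≥ 1` hits `0` before the negative integers
with probability `h_r^{(0)}(l)`. -/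
theorem stmt3 {Ω : Type*} [MeasurableSpace Ω] (μ : Measure Ω) [IsProbabilityMeasure μ]
    (r : ℝ) (hr : r ∈ Set.Ioc (-1 : ℝ) 1)
    (ν : ℤ → ℝ) (hprob : IsProbDist ν) (hν2 : 0 < ν (-2))
    (hharm : NuHarmonic ν (h0 r))
    (Y : ℕ → Ω → ℤ) (hmeas : ∀ j, Measurable (Y j))
    (hindep : iIndepFun Y μ)
    (hlaw : ∀ j k, μ (Y j ⁻¹' {k}) = ENNReal.ofReal (ν k))
    (l : ℤ) (hl : 1 ≤ l) :
    μ {ω | ∃ i : ℕ,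
        (∀ j < i, 0 < l + ∑ m ∈ Finset.range j, Y m ω) ∧
        l + ∑ m ∈ Finset.range i, Y m ω = 0} = ENNReal.ofReal (h0 r l) := by
  set N : ℤ → ENNReal := fun k => ENNReal.ofReal (ν k) with hN
  set H : ℤ → ENNReal := fun k => ENNReal.ofReal (h0 r k) with hH
  have hharmE (k : ℤ) (hk : 0 < k) : ∑' j, N (j - k) * H j = H k := by
    have h := hharm.2 k hk
    rw [← (Equiv.addLeft k).tsum_eq]
    simp only [Equiv.coe_addLeft, add_sub_cancel_left, hN, hH]
    rw [← h.tsum_eq, ENNReal.ofReal_tsum_of_nonneg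
      (fun j => mul_nonneg (hharm.1 _) (hprob.1 _)) h.summable]
    refine tsum_congr fun j => ?_
    rw [mul_comm, ENNReal.ofReal_mul (hharm.1 _)]
  set q : ℕ → ℤ → ENNReal := fun n k => μ (positiveUntil Y l n k) with hq
  let W : ℕ → ENNReal := fun n => ∑' k : ℤ, if 0 < k then q n k * H k else 0
  have hW0 : W 0 = H l := by
    have hl0 : 0 < l := hl
    simp only [W]
    rw [tsum_eq_single l]
    · simp [hl0, hq, positiveUntil]
    · intro k hk
      simp [hq, positiveUntil, hk.symm]
  have hWsucc (n : ℕ) : W n = q (n + 1) 0 + W (n + 1) := by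
    have hterm (k : ℤ) : q (n + 1) k * H k =
        (if k = 0 then q (n + 1) 0 else 0) + if 0 < k then q (n + 1) k * H k else 0 := by
      rcases lt_trichotomy k 0 with hk | rfl | hk
      · simp [hH, h0_of_neg r hk, hk.ne]
      · simp [hH, h0_zero]
      · simp [hk, hk.ne']
    calc W n = ∑' i : ℤ, ∑' k, (if 0 < i then q n i * N (k - i) else 0) * H k := by
          refine tsum_congr fun i => ?_
          split_ifs with hi
          · rw [← hharmE i hi, ← ENNReal.tsum_mul_left]
            exact tsum_congr fun k => by rw [mul_assoc]
          · simp
      _ = ∑' k, q (n + 1) k * H k := by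
          rw [ENNReal.tsum_comm]
          refine tsum_congr fun k => ?_
          rw [ENNReal.tsum_mul_right]
          simp only [hq]
          rw [measure_positiveUntil_succ hindep hmeas hlaw]
      _ = _ := by
          rw [tsum_congr hterm, ENNReal.tsum_add, tsum_ite_eq]
  have hq00 : q 0 0 = 0 := by
    have : l ≠ 0 := by omega
    simp [hq, positiveUntil, this]
  have hWsum (n : ℕ) : ∑ i ∈ Finset.range (n + 1), q i 0 + W n = H l := by
    induction n with
    | zero => simp [hq00, hW0]
    | succ n ih => rw [Finset.sum_range_succ, add_assoc, ← hWsucc, ih]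
  have hWlim : Filter.Tendsto W Filter.atTop (nhds 0) := by
    refine tendsto_tsum_pos_mul (fun n => ?_) (fun k => ?_) (fun k => ENNReal.ofReal_ne_top) ?_
    · simpa using tsum_measure_positiveUntil_le (μ := μ) (l := l) hmeas n
    · exact ENNReal.tendsto_atTop_zero_of_tsum_ne_top
        (tsum_measure_positiveUntil_ne_top (by simpa [hN] using hν2) hindep hmeas hlaw k)
    · rw [← ENNReal.ofReal_zero]
      exact (ENNReal.continuous_ofReal.tendsto 0).comp (tendsto_h0 hr)
  have hset : {ω | ∃ i : ℕ,
      (∀ j < i, 0 < l + ∑ m ∈ Finset.range j, Y m ω) ∧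
      l + ∑ m ∈ Finset.range i, Y m ω = 0} = ⋃ i, positiveUntil Y l i 0 := by
    ext ω; simp [positiveUntil]
  rw [hset, measure_iUnion (disjoint_positiveUntil_of_nonpos le_rfl)
    fun n => measurableSet_positiveUntil hmeas n 0]
  have hlim : Filter.Tendsto (fun n => ∑ i ∈ Finset.range (n + 1), q i 0 + W n) Filter.atTop
      (nhds (∑' i, q i 0 + 0)) :=
    ((ENNReal.tendsto_nat_tsum fun i => q i 0).comp (Filter.tendsto_add_atTop_nat 1)).add hWlim
  simp only [hWsum, add_zero] at hlim
  exact tendsto_nhds_unique hlim tendsto_const_nhds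
end

section
/- Suppose r ∈ (-1,1] and ν is a probability distribution on ℤ such that h_r^{(1)} is ν-harmonic on ℤ_{>0} and 𝓛_ν < ∞. Then for every t ≥ 0 and every θ ∈ ℝ, the characteristic function of the rescaled random walk converges: with X_0 = 0, lim_{n→∞} E[exp(i·θ·n^{-2/3}·X_{⌊nt⌋})] = lim_{n→∞} (φ_ν(n^{-2/3}θ))^{⌊nt⌋} = exp(-t·√((1+r)/2)·𝓛_ν·|θ|^{1/2}·(|θ| - iθ)). -/
open scoped BigOperators

open MeasureTheory ProbabilityTheory


/-- The coefficients of `(1 - z) ^ (-1/2)`. -/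
noncomputable def invSqrtCoeff (n : ℕ) : ℝ := (Nat.centralBinom n : ℝ) / 4 ^ n

/-- The coefficients of `(1 - z) ^ (1/2)`. -/
noncomputable def sqrtCoeff (n : ℕ) : ℝ :=
  PowerSeries.coeff n ((1 - PowerSeries.X) * PowerSeries.mk invSqrtCoeff)

lemma invSqrtCoeff_zero : invSqrtCoeff 0 = 1 := by simp [invSqrtCoeff]

lemma invSqrtCoeff_nonneg (n : ℕ) : 0 ≤ invSqrtCoeff n := by
  unfold invSqrtCoeff; positivity

lemma invSqrtCoeff_succ (n : ℕ) :
    2 * ((n : ℝ) + 1) * invSqrtCoeff (n + 1) = (2 * n + 1) * invSqrtCoeff n := by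
  have h := Nat.succ_mul_centralBinom_succ n
  have h' : ((n : ℝ) + 1) * Nat.centralBinom (n + 1) = 2 * (2 * n + 1) * Nat.centralBinom n := by
    exact_mod_cast h
  unfold invSqrtCoeff
  rw [pow_succ]
  field_simp
  linarith

lemma sqrtCoeff_zero : sqrtCoeff 0 = 1 := by
  simp [sqrtCoeff, sub_mul, invSqrtCoeff_zero]

lemma sqrtCoeff_succ (n : ℕ) :
    sqrtCoeff (n + 1) = invSqrtCoeff (n + 1) - invSqrtCoeff n := by
  simp [sqrtCoeff, sub_mul, PowerSeries.coeff_succ_X_mul]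

lemma mk_sqrtCoeff :
    PowerSeries.mk sqrtCoeff = (1 - PowerSeries.X) * PowerSeries.mk invSqrtCoeff := by
  ext n; simp [sqrtCoeff]

open PowerSeries in
lemma one_sub_X_mul_derivative_invSqrt :
    2 * ((1 - X) * derivative ℝ (mk invSqrtCoeff)) = mk invSqrtCoeff := by
  have h2 : (2 : ℝ⟦X⟧) = C (2 : ℝ) := (map_ofNat C 2).symm
  ext n
  rw [h2, coeff_C_mul, sub_mul, one_mul, map_sub]
  cases n with
  | zero =>
    have := invSqrtCoeff_succ 0
    simp [coeff_derivative] at this ⊢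
    linarith
  | succ n =>
    have := invSqrtCoeff_succ (n + 1)
    simp [coeff_derivative, coeff_succ_X_mul] at this ⊢
    linarith

open PowerSeries in
lemma one_sub_X_mul_invSqrt_sq :
    (1 - X) * (mk invSqrtCoeff) ^ 2 = 1 := by
  apply derivative.ext
  · have h := one_sub_X_mul_derivative_invSqrt
    simp only [Derivation.leibniz, map_sub, derivative_X, smul_eq_mul, Derivation.leibniz_pow,
      nsmul_eq_mul, Derivation.map_one_eq_zero]
    linear_combination (mk invSqrtCoeff) * h
  · simp [invSqrtCoeff_zero]

open PowerSeries in
lemma mk_sqrtCoeff_sq : (mk sqrtCoeff) ^ 2 = 1 - X := by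
  rw [mk_sqrtCoeff]
  linear_combination (1 - X) * one_sub_X_mul_invSqrt_sq

lemma abs_sqrtCoeff_succ (n : ℕ) :
    |sqrtCoeff (n + 1)| = invSqrtCoeff n - invSqrtCoeff (n + 1) := by
  rw [sqrtCoeff_succ, abs_of_nonpos, neg_sub]
  have h := invSqrtCoeff_succ n
  have h1 := invSqrtCoeff_nonneg (n + 1)
  have h0 := invSqrtCoeff_nonneg n
  have hn : (0 : ℝ) ≤ n := n.cast_nonneg
  by_contra hc
  nlinarith

lemma sum_abs_sqrtCoeff_succ_le (n : ℕ) :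
    ∑ i ∈ Finset.range n, |sqrtCoeff (i + 1)| ≤ 1 := by
  simp_rw [abs_sqrtCoeff_succ, Finset.sum_range_sub', invSqrtCoeff_zero]
  linarith [invSqrtCoeff_nonneg n]

lemma summable_abs_sqrtCoeff : Summable fun n => |sqrtCoeff n| :=
  (summable_nat_add_iff 1).1 <|
    summable_of_sum_range_le (fun _ => abs_nonneg _) sum_abs_sqrtCoeff_succ_le

/-- The branch of `√(1 - z)` with nonnegative real part, as a power series on the closed disc. -/
noncomputable def sqrtOneSub (z : ℂ) : ℂ := ∑' n : ℕ, (sqrtCoeff n : ℂ) * z ^ n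

lemma norm_sqrtCoeff_mul_pow_le {z : ℂ} (hz : ‖z‖ ≤ 1) (n : ℕ) :
    ‖(sqrtCoeff n : ℂ) * z ^ n‖ ≤ |sqrtCoeff n| := by
  rw [norm_mul, norm_pow, Complex.norm_real, Real.norm_eq_abs]
  exact mul_le_of_le_one_right (abs_nonneg _) (pow_le_one₀ (norm_nonneg _) hz)

lemma summable_norm_sqrtCoeff_mul_pow {z : ℂ} (hz : ‖z‖ ≤ 1) :
    Summable fun n => ‖(sqrtCoeff n : ℂ) * z ^ n‖ :=
  summable_abs_sqrtCoeff.of_nonneg_of_le (fun _ => norm_nonneg _) (norm_sqrtCoeff_mul_pow_le hz)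

lemma sqrtOneSub_sq {z : ℂ} (hz : ‖z‖ ≤ 1) : sqrtOneSub z ^ 2 = 1 - z := by
  have hs := summable_norm_sqrtCoeff_mul_pow hz
  have hc (n : ℕ) : ∑ kl ∈ Finset.HasAntidiagonal.antidiagonal n,
      (sqrtCoeff kl.1 : ℂ) * z ^ kl.1 * ((sqrtCoeff kl.2 : ℂ) * z ^ kl.2)
      = ((PowerSeries.coeff n (1 - PowerSeries.X : PowerSeries ℝ) : ℝ) : ℂ) * z ^ n := by
    rw [← mk_sqrtCoeff_sq, sq, PowerSeries.coeff_mul]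
    push_cast
    rw [Finset.sum_mul]
    refine Finset.sum_congr rfl fun kl hkl => ?_
    rw [← Finset.HasAntidiagonal.mem_antidiagonal.1 hkl, pow_add]
    simp only [PowerSeries.coeff_mk]
    ring
  rw [sq, sqrtOneSub, tsum_mul_tsum_eq_tsum_sum_antidiagonal_of_summable_norm hs hs]
  simp_rw [hc]
  rw [tsum_eq_sum (s := Finset.range 2)]
  · simp [Finset.sum_range_succ, PowerSeries.coeff_one, PowerSeries.coeff_X, sub_eq_add_neg]
  · intro n hn
    have : n ≠ 0 ∧ n ≠ 1 := by simp at hn; omega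
    simp [PowerSeries.coeff_one, PowerSeries.coeff_X, this]

lemma re_sqrtOneSub_nonneg {z : ℂ} (hz : ‖z‖ ≤ 1) : 0 ≤ (sqrtOneSub z).re := by
  have hs := summable_norm_sqrtCoeff_mul_pow hz
  have h : ‖∑' n : ℕ, (sqrtCoeff (n + 1) : ℂ) * z ^ (n + 1)‖ ≤ 1 :=
    tsum_of_norm_bounded
      ((summable_nat_add_iff 1).2 summable_abs_sqrtCoeff).hasSum
      (fun n => norm_sqrtCoeff_mul_pow_le hz (n + 1)) |>.trans
      (Real.tsum_le_of_sum_range_le (fun _ => abs_nonneg _) sum_abs_sqrtCoeff_succ_le)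
  rw [sqrtOneSub, hs.of_norm.tsum_eq_zero_add, sqrtCoeff_zero]
  have := (Complex.abs_re_le_norm _).trans h
  simp only [Complex.ofReal_one, pow_zero, mul_one, Complex.add_re, Complex.one_re]
  linarith [(abs_le.1 this).1]

lemma continuousOn_sqrtOneSub : ContinuousOn sqrtOneSub (Metric.closedBall 0 1) :=
  continuousOn_tsum (fun n => by fun_prop) summable_abs_sqrtCoeff
    fun n _ hz => norm_sqrtCoeff_mul_pow_le (by simpa using hz) n

lemma sqrtOneSub_neg_ofReal {r : ℝ} (hr : r ∈ Set.Ioc (-1 : ℝ) 1) :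
    sqrtOneSub (-(r : ℂ)) = (Real.sqrt (1 + r) : ℝ) := by
  have hz : ‖-(r : ℂ)‖ ≤ 1 := by
    rw [norm_neg, Complex.norm_real, Real.norm_eq_abs, abs_le]; exact ⟨hr.1.le, hr.2⟩
  have h1 := sqrtOneSub_sq hz
  have h2 : (0 : ℝ) < 1 + r := by linarith [hr.1]
  have h3 : ((Real.sqrt (1 + r) : ℝ) : ℂ) ^ 2 = 1 + r := by
    rw [← Complex.ofReal_pow, Real.sq_sqrt h2.le]; push_cast; ring
  rcases sq_eq_sq_iff_eq_or_eq_neg.1 (h1.trans (by rw [h3]; ring)) with h | h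
  · exact h
  · have := re_sqrtOneSub_nonneg hz
    rw [h] at this
    simp at this
    linarith [Real.sqrt_pos.2 h2]

/-- Square roots with nonnegative real part converge when their squares do. -/
lemma tendsto_of_sq_tendsto {ι : Type*} {l : Filter ι} {w : ι → ℂ} {c : ℂ} (hc : 0 < c.re)
    (hw : ∀ᶠ i in l, 0 ≤ (w i).re) (h : Filter.Tendsto (fun i => w i ^ 2) l (nhds (c ^ 2))) :
    Filter.Tendsto w l (nhds c) := by
  rw [tendsto_iff_norm_sub_tendsto_zero] at h ⊢
  have h' : Filter.Tendsto (fun i => ‖w i ^ 2 - c ^ 2‖ / c.re) l (nhds 0) := by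
    simpa using h.div_const c.re
  refine squeeze_zero' (Filter.Eventually.of_forall fun _ => norm_nonneg _) ?_ h'
  filter_upwards [hw] with i hi
  rw [le_div_iff₀ hc, show w i ^ 2 - c ^ 2 = (w i - c) * (w i + c) by ring, norm_mul]
  refine mul_le_mul_of_nonneg_left ?_ (norm_nonneg _)
  refine le_trans ?_ (Complex.re_le_norm _)
  simpa using hi

lemma h1_of_nonpos (r : ℝ) {l : ℤ} (hl : l ≤ 0) : h1 r l = 0 := by
  rw [h1, if_neg (by omega)]

lemma h1_natCast_succ (r : ℝ) (n : ℕ) :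
    h1 r ((n : ℤ) + 1) = ∑ p ∈ Finset.range (n + 1), h0 r (p : ℤ) := by
  rw [h1, if_pos (by omega)]
  rfl

open PowerSeries in
lemma mk_h0 (r : ℝ) :
    mk (fun n : ℕ => h0 r n) = mk invSqrtCoeff * rescale (-r) (mk invSqrtCoeff) := by
  ext n
  rw [coeff_mul, Finset.Nat.sum_antidiagonal_eq_sum_range_succ_mk, coeff_mk, h0,
    if_pos (by omega), Finset.mul_sum]
  simp only [Int.toNat_natCast]
  refine Finset.sum_congr rfl fun m hm => ?_
  have hmn : m ≤ n := by simpa [Nat.lt_succ_iff] using hm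
  have h4 : (4 : ℝ) ^ (-(n : ℤ)) = (4 ^ m * 4 ^ (n - m))⁻¹ := by
    rw [zpow_neg, zpow_natCast, ← pow_add, Nat.add_sub_cancel' hmn]
  simp only [coeff_mk, coeff_rescale, invSqrtCoeff, Nat.centralBinom_eq_two_mul_choose, h4]
  field_simp

open PowerSeries in
lemma one_sub_X_mul_mk_h1 (r : ℝ) :
    (1 - X) * mk (fun n : ℕ => h1 r ((n : ℤ) + 1)) = mk (fun n : ℕ => h0 r n) := by
  ext n
  cases n with
  | zero => simp [sub_mul, h1]
  | succ n =>
    simp only [sub_mul, one_mul, map_sub, coeff_succ_X_mul, coeff_mk, h1_natCast_succ]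
    rw [Finset.sum_range_succ]
    ring

/-- The coefficients of `√((1 - z) * (1 + r * z))`, obtained from `h1` by finite differences. -/
noncomputable def diffCoeff (r : ℝ) (n : ℤ) : ℝ :=
  h1 r (n + 1) - (2 - r) * h1 r n + (1 - 2 * r) * h1 r (n - 1) + r * h1 r (n - 2)

lemma diffCoeff_of_neg (r : ℝ) {n : ℤ} (hn : n < 0) : diffCoeff r n = 0 := by
  simp [diffCoeff, h1_of_nonpos r (l := n + 1) (by omega), h1_of_nonpos r (l := n) (by omega),
    h1_of_nonpos r (l := n - 1) (by omega), h1_of_nonpos r (l := n - 2) (by omega)]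

open PowerSeries in
lemma mk_diffCoeff (r : ℝ) :
    mk (fun n : ℕ => diffCoeff r n) = mk sqrtCoeff * rescale (-r) (mk sqrtCoeff) := by
  have hR : rescale (-r) (mk sqrtCoeff) = (1 + C r * X) * rescale (-r) (mk invSqrtCoeff) := by
    rw [mk_sqrtCoeff, map_mul, map_sub, map_one, rescale_X, map_neg]
    ring
  have hH := one_sub_X_mul_mk_h1 r
  rw [mk_h0] at hH
  have hP : mk (fun n : ℕ => diffCoeff r n)
      = mk (fun n : ℕ => h1 r ((n : ℤ) + 1))
        - C (2 - r) * (X ^ 1 * mk (fun n : ℕ => h1 r ((n : ℤ) + 1)))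
        + C (1 - 2 * r) * (X ^ 2 * mk (fun n : ℕ => h1 r ((n : ℤ) + 1)))
        + C r * (X ^ 3 * mk (fun n : ℕ => h1 r ((n : ℤ) + 1))) := by
    have hshift (k n : ℕ) : coeff n (X ^ k * mk (fun n : ℕ => h1 r ((n : ℤ) + 1)))
        = h1 r ((n : ℤ) + 1 - k) := by
      rw [coeff_X_pow_mul']
      split_ifs with h
      · rw [coeff_mk]; congr 1; omega
      · rw [h1_of_nonpos]; omega
    ext n
    have e1 : (n : ℤ) + 1 - (1 : ℕ) = n := by push_cast; ring
    have e2 : (n : ℤ) + 1 - (2 : ℕ) = n - 1 := by push_cast; ring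
    have e3 : (n : ℤ) + 1 - (3 : ℕ) = n - 2 := by push_cast; ring
    rw [map_add, map_add, map_sub, coeff_C_mul, coeff_C_mul, coeff_C_mul, hshift, hshift, hshift,
      e1, e2, e3, coeff_mk, coeff_mk, diffCoeff]
  rw [hP, hR, mk_sqrtCoeff]
  simp only [map_sub, map_mul, map_one, map_ofNat]
  linear_combination (1 - X) * (1 + C r * X) * hH

lemma diffCoeff_natCast (r : ℝ) (n : ℕ) :
    diffCoeff r n = ∑ kl ∈ Finset.HasAntidiagonal.antidiagonal n,
      sqrtCoeff kl.1 * ((-r) ^ kl.2 * sqrtCoeff kl.2) := by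
  have := congrArg (PowerSeries.coeff n) (mk_diffCoeff r)
  simpa [PowerSeries.coeff_mul] using this

lemma hasSum_diffCoeff {r : ℝ} (hr : r ∈ Set.Ioc (-1 : ℝ) 1) {z : ℂ} (hz : ‖z‖ = 1) :
    HasSum (fun n : ℤ => (diffCoeff r n : ℂ) * z ^ n)
      (sqrtOneSub z * sqrtOneSub (-(r * z))) ∧
    Summable fun n : ℤ => ‖(diffCoeff r n : ℂ) * z ^ n‖ := by
  have hz' : ‖-(r * z)‖ ≤ 1 := by
    rw [norm_neg, norm_mul, hz, mul_one, Complex.norm_real, Real.norm_eq_abs, abs_le]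
    exact ⟨hr.1.le, hr.2⟩
  have hs := summable_norm_sqrtCoeff_mul_pow hz.le
  have hs' := summable_norm_sqrtCoeff_mul_pow hz'
  have hc (n : ℕ) : (diffCoeff r (n : ℤ) : ℂ) * z ^ (n : ℤ)
      = ∑ kl ∈ Finset.HasAntidiagonal.antidiagonal n,
        (sqrtCoeff kl.1 : ℂ) * z ^ kl.1 * ((sqrtCoeff kl.2 : ℂ) * (-(r * z)) ^ kl.2) := by
    rw [diffCoeff_natCast]
    push_cast
    rw [Finset.sum_mul]
    refine Finset.sum_congr rfl fun kl hkl => ?_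
    rw [zpow_natCast, ← Finset.HasAntidiagonal.mem_antidiagonal.1 hkl, pow_add, ← neg_mul, mul_pow]
    ring
  have hinj : Function.Injective ((↑) : ℕ → ℤ) := Nat.cast_injective
  have hout (n : ℤ) (hn : n ∉ Set.range ((↑) : ℕ → ℤ)) : (diffCoeff r n : ℂ) * z ^ n = 0 := by
    rw [diffCoeff_of_neg, Complex.ofReal_zero, zero_mul]
    by_contra h
    exact hn ⟨n.toNat, by omega⟩
  have hN : Summable fun n : ℕ => ‖(diffCoeff r (n : ℤ) : ℂ) * z ^ (n : ℤ)‖ := by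
    have h := summable_norm_sum_mul_antidiagonal_of_summable_norm hs hs'
    simpa only [hc] using h
  constructor
  · refine (hinj.hasSum_iff hout).1 ?_
    rw [sqrtOneSub, sqrtOneSub,
      tsum_mul_tsum_eq_tsum_sum_antidiagonal_of_summable_norm hs hs', ← tsum_congr hc]
    exact hN.of_norm.hasSum
  · exact (hinj.summable_iff (f := fun n : ℤ => ‖(diffCoeff r n : ℂ) * z ^ n‖)
      fun n hn => by rw [hout n hn, norm_zero]).1 hN

lemma h2_natCast_add_two (r : ℝ) (k : ℕ) :
    h2 r ((k : ℤ) + 2) = ∑ i ∈ Finset.range (k + 1), h1 r ((i : ℤ) + 1) := by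
  rw [h2, if_pos (by omega), show ((k : ℤ) + 2).toNat - 1 = k + 1 by omega,
    Finset.range_eq_Ico, ← Finset.Ico_succ_right_eq_Icc,
    Finset.sum_Ico_eq_sum_range, Finset.sum_Ico_eq_sum_range]
  refine Finset.sum_congr (by simp) fun i _ => ?_
  congr 1
  push_cast
  ring

lemma hasSum_overshoot {r : ℝ} {ν : ℤ → ℝ} (hν : ∀ k, 0 ≤ ν k) (hh : ∀ l, 0 ≤ h1 r l)
    (hfin : Summable fun k : ℕ => ν ((k : ℤ) + 1) * h2 r ((k : ℤ) + 2)) :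
    HasSum (fun p : ℕ × ℕ => h1 r ((p.2 : ℤ) + 1) * ν ((p.2 : ℤ) + 1 + p.1)) (Lnu r ν) := by
  set F : ℕ × ℕ → ℝ := fun p => h1 r ((p.2 : ℤ) + 1) * ν ((p.2 : ℤ) + 1 + p.1) with hF
  have hterm (k : ℕ) : ∑ p ∈ Finset.HasAntidiagonal.antidiagonal k, F p
      = ν ((k : ℤ) + 1) * h2 r ((k : ℤ) + 2) := by
    rw [h2_natCast_add_two, ← Finset.Nat.sum_antidiagonal_swap,
      Finset.Nat.sum_antidiagonal_eq_sum_range_succ_mk, Finset.mul_sum]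
    refine Finset.sum_congr rfl fun i hi => ?_
    have : i ≤ k := by simpa [Nat.lt_succ_iff] using hi
    simp only [hF, Prod.fst_swap, Prod.snd_swap]
    rw [show (i : ℤ) + 1 + ((k - i : ℕ) : ℤ) = k + 1 by omega, mul_comm]
  have hnn : 0 ≤ F := fun p => mul_nonneg (hh _) (hν _)
  have hfib (k : ℕ) : HasSum (fun x : Finset.HasAntidiagonal.antidiagonal k => F x)
      (ν ((k : ℤ) + 1) * h2 r ((k : ℤ) + 2)) := by
    rw [← hterm, ← Finset.sum_coe_sort (Finset.HasAntidiagonal.antidiagonal k) F]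
    exact hasSum_fintype _
  have hsum : Summable fun x : Σ k : ℕ, Finset.HasAntidiagonal.antidiagonal k =>
      F (Finset.HasAntidiagonal.sigmaAntidiagonalEquivProd x) := by
    rw [summable_sigma_of_nonneg fun _ => hnn _]
    refine ⟨fun k => (hfib k).summable, ?_⟩
    convert! hfin using 2 with k
    exact (hfib k).tsum_eq
  have hF' : Summable F := Finset.HasAntidiagonal.sigmaAntidiagonalEquivProd.summable_iff.1 hsum
  have h := (Finset.HasAntidiagonal.sigmaAntidiagonalEquivProd.hasSum_iff.2 hF'.hasSum).sigma hfib
  have hL : Lnu r ν = ∑' p, F p := h.tsum_eq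
  rw [hL]
  exact hF'.hasSum

/-- The failure of `ν`-harmonicity of `h1` is a nonnegative summable function of mass `Lnu`. -/
lemma exists_defect {r : ℝ} {ν : ℤ → ℝ} (hν : ∀ k, 0 ≤ ν k) (hcrit : NuHarmonic ν (h1 r))
    (hfin : Summable fun k : ℕ => ν ((k : ℤ) + 1) * h2 r ((k : ℤ) + 2)) :
    ∃ g : ℤ → ℝ, (∀ k, 0 ≤ g k) ∧ HasSum g (Lnu r ν) ∧
      ∀ k, HasSum (fun l => h1 r (k + l) * ν l) (h1 r k + g k) := by
  have hF := hasSum_overshoot hν hcrit.1 hfin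
  set q : ℕ → ℝ := fun j => ∑' i : ℕ, h1 r ((i : ℤ) + 1) * ν ((i : ℤ) + 1 + j) with hq
  have hqs (j : ℕ) : HasSum (fun i : ℕ => h1 r ((i : ℤ) + 1) * ν ((i : ℤ) + 1 + j)) (q j) :=
    (hF.summable.prod_factor j).hasSum
  have hqL : HasSum q (Lnu r ν) := hF.prod_fiberwise hqs
  have hinj : Function.Injective fun j : ℕ => -(j : ℤ) := fun a b h => by simpa using h
  refine ⟨fun k => if 1 ≤ k then 0 else q (-k).toNat, fun k => ?_, ?_, fun k => ?_⟩
  · dsimp only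
    split_ifs
    · exact le_rfl
    · exact (hqs _).nonneg fun i => mul_nonneg (hcrit.1 _) (hν _)
  · refine (hinj.hasSum_iff fun k hk => if_pos ?_).1 ?_
    · by_contra h
      exact hk ⟨(-k).toNat, by simp only; omega⟩
    · convert! hqL using 1
      ext j
      simp only [Function.comp_apply]
      rw [if_neg (by omega)]
      simp
  · dsimp only
    split_ifs with hk
    · simpa using hcrit.2 k hk
    · obtain ⟨j, rfl⟩ : ∃ j : ℕ, k = -(j : ℤ) := ⟨(-k).toNat, by omega⟩
      have hinj' : Function.Injective fun i : ℕ => (i : ℤ) + 1 + j := fun a b h => by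
        simp only at h; omega
      rw [h1_of_nonpos r (by omega : -(j : ℤ) ≤ 0), zero_add, neg_neg, Int.toNat_natCast]
      refine (hinj'.hasSum_iff fun l hl => ?_).1 ?_
      · rw [h1_of_nonpos, zero_mul]
        by_contra h
        exact hl ⟨(l - 1 - j).toNat, by simp only; omega⟩
      · convert! hqs j using 2 with i
        simp only [Function.comp_apply]
        congr 2
        ring

lemma summable_ofReal_mul_zpow {g : ℤ → ℝ} (hg : Summable fun k => |g k|) {z : ℂ} (hz : ‖z‖ = 1) :
    Summable fun k : ℤ => ‖(g k : ℂ) * z ^ k‖ := by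
  simpa [norm_zpow, hz] using hg

lemma hasSum_shift_mul_zpow {g : ℤ → ℝ} {z G : ℂ} (hz : z ≠ 0)
    (hG : HasSum (fun k : ℤ => (g k : ℂ) * z ^ k) G) (m : ℤ) :
    HasSum (fun k : ℤ => (g (k + m) : ℂ) * z ^ k) (z ^ (-m) * G) := by
  have h := ((Equiv.addRight m).hasSum_iff.2 hG).mul_left (z ^ (-m))
  convert! h using 2 with k
  simp only [Function.comp_apply, Equiv.coe_addRight]
  rw [mul_left_comm, ← zpow_add₀ hz]
  congr 2
  ring

lemma hasSum_mul_of_summable_norm {ι κ : Type*} {f : ι → ℂ} {g : κ → ℂ} {A B : ℂ}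
    (hf : HasSum f A) (hg : HasSum g B) (hfn : Summable fun i => ‖f i‖)
    (hgn : Summable fun k => ‖g k‖) : HasSum (fun p : ι × κ => f p.1 * g p.2) (A * B) :=
  hf.mul hg (summable_mul_of_summable_norm hfn hgn)

/-- Fourier transform of the correlation of two absolutely summable sequences. -/
lemma hasSum_correlation {a ν b : ℤ → ℝ} {z A φ : ℂ} (hz : ‖z‖ = 1)
    (ha : HasSum (fun k : ℤ => (a k : ℂ) * z ^ k) A)
    (ha' : Summable fun k : ℤ => ‖(a k : ℂ) * z ^ k‖)
    (hν : HasSum (fun l : ℤ => (ν l : ℂ) * z ^ (-l)) φ)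
    (hν' : Summable fun l : ℤ => ‖(ν l : ℂ) * z ^ (-l)‖)
    (hb : ∀ k, HasSum (fun l => a (k + l) * ν l) (b k)) :
    HasSum (fun k : ℤ => (b k : ℂ) * z ^ k) (A * φ) := by
  have hz0 : z ≠ 0 := by rintro rfl; simp at hz
  have hprod := hasSum_mul_of_summable_norm ha hν ha' hν'
  obtain ⟨e, he⟩ : ∃ e : ℤ × ℤ ≃ ℤ × ℤ, ∀ p, e p = (p.1 + p.2, p.2) :=
    ⟨⟨fun p => (p.1 + p.2, p.2), fun p => (p.1 - p.2, p.2), fun p => by simp, fun p => by simp⟩,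
      fun _ => rfl⟩
  have hshear : HasSum (fun p : ℤ × ℤ => ((a (p.1 + p.2) * ν p.2 : ℝ) : ℂ) * z ^ p.1)
      (A * φ) := by
    refine (e.hasSum_iff.2 hprod).congr_fun fun p => ?_
    simp only [Function.comp_apply, he]
    rw [zpow_add₀ hz0, zpow_neg]
    have := zpow_ne_zero p.2 hz0
    push_cast
    field_simp
  exact hshear.prod_fiberwise fun k => (Complex.hasSum_ofReal.2 (hb k)).mul_right (z ^ k)

lemma phi_identity {r : ℝ} (hr : r ∈ Set.Ioc (-1 : ℝ) 1) {ν g : ℤ → ℝ} {z φ G : ℂ} (hz : ‖z‖ = 1)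
    (hνs : Summable fun l => |ν l|) (hν : HasSum (fun l : ℤ => (ν l : ℂ) * z ^ (-l)) φ)
    (hG : HasSum (fun k : ℤ => (g k : ℂ) * z ^ k) G)
    (hg : ∀ k, HasSum (fun l => h1 r (k + l) * ν l) (h1 r k + g k)) :
    sqrtOneSub z * sqrtOneSub (-(r * z)) * (φ - 1) = (1 - z) ^ 2 * (1 + r * z) * G / z := by
  have hz0 : z ≠ 0 := by rintro rfl; simp at hz
  obtain ⟨hA, hA'⟩ := hasSum_diffCoeff hr hz
  have hb (k : ℤ) : HasSum (fun l => diffCoeff r (k + l) * ν l)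
      (diffCoeff r k +
        (g (k + 1) - (2 - r) * g k + (1 - 2 * r) * g (k - 1) + r * g (k - 2))) := by
    have h := (((hg (k + 1)).sub ((hg k).mul_left (2 - r))).add
      ((hg (k - 1)).mul_left (1 - 2 * r))).add ((hg (k - 2)).mul_left r)
    convert! h using 1
    · ext l
      rw [diffCoeff, show k + l + 1 = k + 1 + l by ring, show k + l - 1 = k - 1 + l by ring,
        show k + l - 2 = k - 2 + l by ring]
      ring
    · rw [diffCoeff]; ring
  have hν' : Summable fun l : ℤ => ‖(ν l : ℂ) * z ^ (-l)‖ := by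
    simpa [norm_zpow, hz] using hνs
  have h₁ := hasSum_correlation hz hA hA' hν hν' hb
  have h₂ := hA.add ((((hasSum_shift_mul_zpow hz0 hG 1).sub (hG.mul_left (2 - (r : ℂ)))).add
      ((hasSum_shift_mul_zpow hz0 hG (-1)).mul_left (1 - 2 * (r : ℂ)))).add
      ((hasSum_shift_mul_zpow hz0 hG (-2)).mul_left (r : ℂ)))
  have h₃ := h₁.unique (h₂.congr_fun fun k => ?_)
  · rw [mul_sub, h₃]
    simp only [neg_neg, zpow_neg, zpow_ofNat]
    field_simp
    ring
  · push_cast [← sub_eq_add_neg]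
    ring

lemma summable_abs_of_isProbDist {ν : ℤ → ℝ} (hν : IsProbDist ν) : Summable fun k => |ν k| := by
  simpa only [abs_of_nonneg (hν.1 _)] using hν.2.summable

lemma norm_exp_neg_I_mul (s : ℝ) : ‖Complex.exp (-(Complex.I * s))‖ = 1 := by
  rw [← mul_neg, mul_comm, ← Complex.ofReal_neg]
  exact Complex.norm_exp_ofReal_mul_I _

lemma hasSum_phiNu {ν : ℤ → ℝ} (hν : IsProbDist ν) (s : ℝ) :
    HasSum (fun l : ℤ => (ν l : ℂ) * Complex.exp (-(Complex.I * s)) ^ (-l)) (phiNu ν s) := by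
  have hs : Summable fun l : ℤ => ‖(ν l : ℂ) * Complex.exp (-(Complex.I * s)) ^ (-l)‖ := by
    simpa [norm_zpow, norm_exp_neg_I_mul] using summable_abs_of_isProbDist hν
  convert! hs.of_norm.hasSum using 1
  rw [phiNu]
  refine tsum_congr fun l => ?_
  rw [← Complex.exp_int_mul]
  congr 2
  push_cast
  ring

lemma phiNu_sub_one {r : ℝ} (hr : r ∈ Set.Ioc (-1 : ℝ) 1) {ν g : ℤ → ℝ} {s : ℝ} {z G : ℂ}
    (hν : IsProbDist ν) (hz : z = Complex.exp (-(Complex.I * s))) (hrz : 1 + r * z ≠ 0)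
    (hG : HasSum (fun k : ℤ => (g k : ℂ) * z ^ k) G)
    (hg : ∀ k, HasSum (fun l => h1 r (k + l) * ν l) (h1 r k + g k)) :
    phiNu ν s - 1 = sqrtOneSub z * sqrtOneSub (-(r * z)) * (1 - z) * G / z := by
  have hz1 : ‖z‖ = 1 := hz ▸ norm_exp_neg_I_mul s
  have hφ := hasSum_phiNu hν s
  rw [← hz] at hφ
  by_cases h1z : z = 1
  · have h : HasSum (fun l : ℤ => (ν l : ℂ) * z ^ (-l)) ((1 : ℝ) : ℂ) := by
      simpa [h1z] using Complex.hasSum_ofReal.2 hν.2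
    rw [hφ.unique h, h1z]
    simp
  have hrz1 : ‖-(r * z)‖ ≤ 1 := by
    rw [norm_neg, norm_mul, hz1, mul_one, Complex.norm_real, Real.norm_eq_abs, abs_le]
    exact ⟨hr.1.le, hr.2⟩
  have hsq := sqrtOneSub_sq hz1.le
  have hsq' := sqrtOneSub_sq hrz1
  rw [sub_neg_eq_add] at hsq'
  have hne : sqrtOneSub z ≠ 0 := fun h => sub_ne_zero.2 (Ne.symm h1z) (by rw [← hsq, h]; ring)
  have hne' : sqrtOneSub (-(r * z)) ≠ 0 := fun h => hrz (by rw [← hsq', h]; ring)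
  refine mul_left_cancel₀ (mul_ne_zero hne hne') ?_
  rw [phi_identity hr hz1 (summable_abs_of_isProbDist hν) hφ hG hg, ← hsq']
  linear_combination (-(1 - z) * sqrtOneSub (-(r * z)) ^ 2 * G / z) * hsq

lemma tendsto_inv_mul_one_sub_exp (θ : ℝ) :
    Filter.Tendsto
      (fun ε : ℝ => (ε : ℂ)⁻¹ * (1 - Complex.exp (-(Complex.I * ((ε * θ : ℝ) : ℂ)))))
      (nhdsWithin 0 (Set.Ioi 0)) (nhds (Complex.I * θ)) := by
  have hd : HasDerivAt (fun ε : ℝ => -Complex.exp (-(Complex.I * ((ε * θ : ℝ) : ℂ))))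
      (Complex.I * θ) 0 := by
    have h := (((((hasDerivAt_id (0 : ℝ)).mul_const θ).ofReal_comp).const_mul
      Complex.I).neg.cexp).neg
    exact HasDerivAt.congr_deriv h (by simp)
  have h := hd.tendsto_slope_zero.mono_left (nhdsWithin_mono 0 fun x (hx : 0 < x) => hx.ne')
  refine h.congr fun ε => ?_
  simp
  ring

lemma continuous_tsum_mul_exp_zpow {g : ℤ → ℝ} (hg : Summable fun k => |g k|) (θ : ℝ) :
    Continuous fun ε : ℝ =>
      ∑' k : ℤ, (g k : ℂ) * Complex.exp (-(Complex.I * ((ε * θ : ℝ) : ℂ))) ^ k := by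
  refine continuous_tsum (fun k => ?_) hg fun k ε => ?_
  · simp_rw [← Complex.exp_int_mul]
    fun_prop
  · simp [norm_zpow, norm_exp_neg_I_mul, -Complex.ofReal_mul]

/-- Second order behaviour of the characteristic function at the origin. -/
lemma tendsto_phiNu_sub_one {r : ℝ} (hr : r ∈ Set.Ioc (-1 : ℝ) 1) {ν : ℤ → ℝ}
    (hν : IsProbDist ν) (hcrit : NuHarmonic ν (h1 r))
    (hfin : Summable fun k : ℕ => ν ((k : ℤ) + 1) * h2 r ((k : ℤ) + 2)) (θ : ℝ) :
    Filter.Tendsto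
      (fun ε : ℝ => ((Real.sqrt ε : ℝ) : ℂ)⁻¹ * (ε : ℂ)⁻¹ * (phiNu ν (ε * θ) - 1))
      (nhdsWithin 0 (Set.Ioi 0))
      (nhds (-((Real.sqrt ((1 + r) / 2) * Lnu r ν * |θ| ^ ((1 : ℝ) / 2) : ℝ) : ℂ) *
          (((|θ| : ℝ) : ℂ) - Complex.I * (θ : ℂ)))) := by
  obtain ⟨g, hg0, hgL, hg⟩ := exists_defect hν.1 hcrit hfin
  have hgs : Summable fun k => |g k| := by
    simpa only [abs_of_nonneg (hg0 _)] using hgL.summable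
  rcases eq_or_ne θ 0 with rfl | hθ
  · have h : phiNu ν 0 = 1 := by
      have := (hasSum_phiNu hν 0).unique (by simpa using Complex.hasSum_ofReal.2 hν.2)
      simpa using this
    simp [h]
  set z : ℝ → ℂ := fun ε => Complex.exp (-(Complex.I * ((ε * θ : ℝ) : ℂ))) with hz
  have hz1 (ε : ℝ) : ‖z ε‖ = 1 := norm_exp_neg_I_mul _
  have hzc : Continuous z := by fun_prop
  have hz0 : Filter.Tendsto z (nhdsWithin 0 (Set.Ioi 0)) (nhds 1) := by
    have := hzc.tendsto 0
    simp only [hz, zero_mul, Complex.ofReal_zero, mul_zero, neg_zero, Complex.exp_zero] at this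
    exact this.mono_left nhdsWithin_le_nhds
  have hG : Filter.Tendsto (fun ε => ∑' k : ℤ, (g k : ℂ) * z ε ^ k)
      (nhdsWithin 0 (Set.Ioi 0)) (nhds (Lnu r ν)) := by
    have := (continuous_tsum_mul_exp_zpow hgs θ).tendsto 0
    simp only [zero_mul, Complex.ofReal_zero, mul_zero, neg_zero, Complex.exp_zero, one_zpow,
      mul_one, (Complex.hasSum_ofReal.2 hgL).tsum_eq] at this
    exact this.mono_left nhdsWithin_le_nhds
  have hrz1 (ε : ℝ) : ‖-(r * z ε)‖ ≤ 1 := by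
    rw [norm_neg, norm_mul, hz1, mul_one, Complex.norm_real, Real.norm_eq_abs, abs_le]
    exact ⟨hr.1.le, hr.2⟩
  have hS : Filter.Tendsto (fun ε => sqrtOneSub (-(r * z ε)))
      (nhdsWithin 0 (Set.Ioi 0)) (nhds (Real.sqrt (1 + r) : ℝ)) := by
    rw [← sqrtOneSub_neg_ofReal hr]
    have hmem : -(r : ℂ) ∈ Metric.closedBall (0 : ℂ) 1 := by
      rw [mem_closedBall_zero_iff, norm_neg, Complex.norm_real, Real.norm_eq_abs, abs_le]
      exact ⟨hr.1.le, hr.2⟩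
    refine (continuousOn_sqrtOneSub _ hmem).tendsto.comp
      (tendsto_nhdsWithin_iff.2 ⟨?_, Filter.Eventually.of_forall fun ε => ?_⟩)
    · simpa using (hz0.const_mul (r : ℂ)).neg
    · simpa using hrz1 ε
  have hslope : Filter.Tendsto (fun ε : ℝ => (ε : ℂ)⁻¹ * (1 - z ε))
      (nhdsWithin 0 (Set.Ioi 0)) (nhds (Complex.I * θ)) := tendsto_inv_mul_one_sub_exp θ
  have hθ' : 0 < |θ| := abs_pos.2 hθ
  set q : ℝ := Real.sqrt (|θ| / 2) with hq
  have hq0 : 0 < q := Real.sqrt_pos.2 (by positivity)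
  have hq2 : q ^ 2 = |θ| / 2 := Real.sq_sqrt (by positivity)
  have hθq : θ ^ 2 = 4 * q ^ 4 := by
    rw [← sq_abs, show q ^ 4 = (q ^ 2) ^ 2 by ring, hq2]; ring
  set w₀ : ℂ := q + Complex.I * (θ / (2 * q) : ℝ) with hw₀
  have hw₀sq : w₀ ^ 2 = Complex.I * θ := by
    have h : (q : ℂ) ^ 2 - ((θ / (2 * q) : ℝ) : ℂ) ^ 2 = 0 := by
      norm_cast
      rw [div_pow, hθq]
      field_simp
      ring
    have h' : (q : ℂ) * ((θ / (2 * q) : ℝ) : ℂ) = θ / 2 := by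
      have : q * (θ / (2 * q)) = θ / 2 := by field_simp
      rw [← Complex.ofReal_mul, this]; push_cast; ring
    rw [hw₀]
    linear_combination h + 2 * Complex.I * h' + ((θ / (2 * q) : ℝ) : ℂ) ^ 2 * Complex.I_sq
  have hw : Filter.Tendsto (fun ε : ℝ => ((Real.sqrt ε : ℝ) : ℂ)⁻¹ * sqrtOneSub (z ε))
      (nhdsWithin 0 (Set.Ioi 0)) (nhds w₀) := by
    refine tendsto_of_sq_tendsto (by simpa [hw₀, -Complex.ofReal_div] using hq0) ?_ ?_
    · refine Filter.Eventually.of_forall fun ε => ?_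
      rw [← Complex.ofReal_inv, Complex.re_ofReal_mul]
      exact mul_nonneg (inv_nonneg.2 (Real.sqrt_nonneg _)) (re_sqrtOneSub_nonneg (hz1 ε).le)
    · rw [hw₀sq]
      refine hslope.congr' ?_
      filter_upwards [self_mem_nhdsWithin] with ε hε
      rw [mul_pow, sqrtOneSub_sq (hz1 ε).le, inv_pow, ← Complex.ofReal_pow,
        Real.sq_sqrt (le_of_lt hε)]
  have hmain := (((hw.mul hS).mul hslope).mul hG).div hz0 one_ne_zero
  have hne : ∀ᶠ ε in nhdsWithin (0 : ℝ) (Set.Ioi 0), 1 + r * z ε ≠ 0 := by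
    have h : Filter.Tendsto (fun ε => 1 + r * z ε) (nhdsWithin 0 (Set.Ioi 0))
        (nhds (1 + r * 1)) := (hz0.const_mul (r : ℂ)).const_add 1
    refine h.eventually_ne ?_
    have : (1 + r : ℝ) ≠ 0 := by linarith [hr.1]
    rw [mul_one]
    exact_mod_cast this
  have hval : w₀ * (Real.sqrt (1 + r) : ℝ) * (Complex.I * θ) * Lnu r ν / 1
      = -((Real.sqrt ((1 + r) / 2) * Lnu r ν * |θ| ^ ((1 : ℝ) / 2) : ℝ) : ℂ) *
          (((|θ| : ℝ) : ℂ) - Complex.I * (θ : ℂ)) := by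
    have hs : Real.sqrt ((1 + r) / 2) * |θ| ^ ((1 : ℝ) / 2) = Real.sqrt (1 + r) * q := by
      rw [← Real.sqrt_eq_rpow, hq, ← Real.sqrt_mul (by linarith [hr.1]),
        ← Real.sqrt_mul (by linarith [hr.1])]
      congr 1; ring
    have h₁ : Real.sqrt ((1 + r) / 2) * Lnu r ν * |θ| ^ ((1 : ℝ) / 2)
        = Real.sqrt (1 + r) * q * Lnu r ν := by rw [← hs]; ring
    have h₂ : ((θ / (2 * q) : ℝ) : ℂ) * θ = q * (|θ| : ℝ) := by
      norm_cast
      have : |θ| = 2 * q ^ 2 := by rw [hq2]; ring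
      rw [this]
      field_simp
      linear_combination hθq
    rw [h₁, hw₀]
    push_cast at h₂ ⊢
    linear_combination (-(Real.sqrt (1 + r) * Lnu r ν : ℂ)) * h₂
      + (Real.sqrt (1 + r) * Lnu r ν * (θ / (2 * q)) * θ : ℂ) * Complex.I_sq
  rw [← hval]
  refine hmain.congr' ?_
  filter_upwards [hne] with ε hε
  have hsum : HasSum (fun k : ℤ => (g k : ℂ) * z ε ^ k) (∑' k : ℤ, (g k : ℂ) * z ε ^ k) :=
    (summable_ofReal_mul_zpow hgs (hz1 ε)).of_norm.hasSum
  rw [phiNu_sub_one hr hν rfl hε hsum hg, Pi.div_apply]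
  ring

lemma tendsto_pow_floor_mul {f : ℕ → ℂ} {c : ℂ}
    (hf : Filter.Tendsto (fun n : ℕ => (n : ℂ) * (f n - 1)) Filter.atTop (nhds c))
    {t : ℝ} (ht : 0 ≤ t) :
    Filter.Tendsto (fun n : ℕ => f n ^ ⌊(n : ℝ) * t⌋₊) Filter.atTop
      (nhds (Complex.exp (t * c))) := by
  have hlog : Filter.Tendsto (fun n : ℕ => (n : ℂ) * Complex.log (f n)) Filter.atTop (nhds c) := by
    have := (Complex.tendsto_mul_log_one_add_of_tendsto
      (tendsto_smul_comp_nat_floor_of_tendsto_mul hf)).comp tendsto_natCast_atTop_atTop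
    simpa [Function.comp_def] using this
  have hfl : Filter.Tendsto (fun n : ℕ => ((⌊(n : ℝ) * t⌋₊ / (n : ℝ) : ℝ) : ℂ)) Filter.atTop
      (nhds (t : ℂ)) := by
    have h := (tendsto_nat_floor_mul_div_atTop ht).comp
      (tendsto_natCast_atTop_atTop (R := ℝ))
    simp only [Function.comp_def, mul_comm t] at h
    exact (Complex.continuous_ofReal.tendsto t).comp h
  have hf1 : Filter.Tendsto (fun n => f n) Filter.atTop (nhds 1) := by
    have h := (hf.mul (tendsto_inv_atTop_nhds_zero_nat (𝕜 := ℂ))).add_const 1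
    rw [mul_zero, zero_add] at h
    refine h.congr' ?_
    filter_upwards [Filter.eventually_ne_atTop 0] with n hn
    have : (n : ℂ) ≠ 0 := by exact_mod_cast hn
    field_simp
    ring
  refine ((Complex.continuous_exp.tendsto _).comp (hfl.mul hlog)).congr' ?_
  filter_upwards [Filter.eventually_ne_atTop 0, hf1.eventually_ne one_ne_zero] with n hn hfn
  have : (n : ℂ) ≠ 0 := by exact_mod_cast hn
  have h : f n ^ ⌊(n : ℝ) * t⌋₊ = Complex.exp (⌊(n : ℝ) * t⌋₊ * Complex.log (f n)) := by
    rw [Complex.exp_nat_mul, Complex.exp_log hfn]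
  rw [h, Function.comp_apply]
  congr 1
  push_cast
  field_simp

lemma integral_exp_eq_phiNu {Ω : Type*} [MeasurableSpace Ω] {μ : Measure Ω}
    [IsProbabilityMeasure μ] {ν : ℤ → ℝ} (hν : IsProbDist ν) {Y : Ω → ℤ} (hY : Measurable Y)
    (hlaw : ∀ k, μ (Y ⁻¹' {k}) = ENNReal.ofReal (ν k)) (s : ℝ) :
    ∫ ω, Complex.exp (Complex.I * (Y ω : ℂ) * (s : ℂ)) ∂μ = phiNu ν s := by
  have : IsProbabilityMeasure (μ.map Y) := Measure.isProbabilityMeasure_map hY.aemeasurable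
  have hm : Measurable fun k : ℤ => Complex.exp (Complex.I * (k : ℂ) * (s : ℂ)) :=
    measurable_from_top
  have hnorm (k : ℤ) : ‖Complex.exp (Complex.I * (k : ℂ) * (s : ℂ))‖ ≤ 1 := by
    rw [Complex.norm_exp]; simp
  rw [← integral_map (f := fun k : ℤ => Complex.exp (Complex.I * (k : ℂ) * (s : ℂ)))
    hY.aemeasurable hm.aestronglyMeasurable, integral_countable, phiNu]
  · refine tsum_congr fun k => ?_
    rw [measureReal_def, Measure.map_apply hY (measurableSet_singleton k), hlaw,
      ENNReal.toReal_ofReal (hν.1 k), Complex.real_smul]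
  · exact Integrable.of_bound hm.aestronglyMeasurable 1 (Filter.Eventually.of_forall hnorm)

lemma integral_exp_sum_eq_phiNu_pow {Ω : Type*} [MeasurableSpace Ω] {μ : Measure Ω}
    [IsProbabilityMeasure μ] {ν : ℤ → ℝ} (hν : IsProbDist ν) {Y : ℕ → Ω → ℤ}
    (hmeas : ∀ j, Measurable (Y j))
    (hindep : iIndepFun (m := fun _ : ℕ => (inferInstance : MeasurableSpace ℤ)) Y μ)
    (hlaw : ∀ j k, μ (Y j ⁻¹' {k}) = ENNReal.ofReal (ν k)) (s : ℝ) (m : ℕ) :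
    ∫ ω, Complex.exp (Complex.I * ((∑ j ∈ Finset.range m, Y j ω : ℤ) : ℂ) * (s : ℂ)) ∂μ
      = phiNu ν s ^ m := by
  have hprod (ω : Ω) : Complex.exp (Complex.I * ((∑ j ∈ Finset.range m, Y j ω : ℤ) : ℂ) * (s : ℂ))
      = ∏ j : Fin m, Complex.exp (Complex.I * (Y j ω : ℂ) * (s : ℂ)) := by
    rw [← Complex.exp_sum, ← Finset.sum_range
      (fun j => Complex.I * (Y j ω : ℂ) * (s : ℂ))]
    push_cast
    rw [Finset.mul_sum, Finset.sum_mul]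
  simp_rw [hprod]
  have hind := hindep.precomp (g := fun j : Fin m => (j : ℕ)) Fin.val_injective
  have h := hind.integral_fun_prod_comp (f := fun _ (k : ℤ) =>
      Complex.exp (Complex.I * (k : ℂ) * (s : ℂ)))
    (fun j => (hmeas j).aemeasurable) (fun j => measurable_from_top.aestronglyMeasurable)
  refine h.trans ?_
  simp_rw [integral_exp_eq_phiNu hν (hmeas _) (hlaw _)]
  simp

/-- convergence of the characteristic function of the rescaled walk
(with `X_0 = 0`) towards that of the `3/2`-stable process. -/
theorem stmt16 {Ω : Type*} [MeasurableSpace Ω] (μ : Measure Ω) [IsProbabilityMeasure μ]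
    (r : ℝ) (hr : r ∈ Set.Ioc (-1 : ℝ) 1)
    (ν : ℤ → ℝ) (hprob : IsProbDist ν)
    (hcrit : NuHarmonic ν (h1 r))
    (hfin : Summable fun k : ℕ => ν ((k : ℤ) + 1) * h2 r ((k : ℤ) + 2))
    (Y : ℕ → Ω → ℤ) (hmeas : ∀ j, Measurable (Y j))
    (hindep : iIndepFun (m := fun _ : ℕ => (inferInstance : MeasurableSpace ℤ)) Y μ)
    (hlaw : ∀ j k, μ (Y j ⁻¹' {k}) = ENNReal.ofReal (ν k))
    (t : ℝ) (ht : 0 ≤ t) (θ : ℝ) :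
    Filter.Tendsto
      (fun n : ℕ => ∫ ω, Complex.exp (Complex.I * (θ : ℂ) *
          (((n : ℝ) ^ (-(2 : ℝ) / 3) : ℝ) : ℂ) *
          ((((∑ m ∈ Finset.range ⌊(n : ℝ) * t⌋₊, Y m ω : ℤ) : ℝ)) : ℂ)) ∂μ)
      Filter.atTop
      (nhds (Complex.exp
        (-(((t * Real.sqrt ((1 + r) / 2) * Lnu r ν * |θ| ^ ((1 : ℝ) / 2) : ℝ)) : ℂ) *
          (((|θ| : ℝ) : ℂ) - Complex.I * (θ : ℂ))))) ∧
    Filter.Tendsto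
      (fun n : ℕ => (phiNu ν (((n : ℝ) ^ (-(2 : ℝ) / 3)) * θ)) ^ ⌊(n : ℝ) * t⌋₊)
      Filter.atTop
      (nhds (Complex.exp
        (-(((t * Real.sqrt ((1 + r) / 2) * Lnu r ν * |θ| ^ ((1 : ℝ) / 2) : ℝ)) : ℂ) *
          (((|θ| : ℝ) : ℂ) - Complex.I * (θ : ℂ))))) := by
  have hε : Filter.Tendsto (fun n : ℕ => (n : ℝ) ^ (-(2 : ℝ) / 3)) Filter.atTop
      (nhdsWithin 0 (Set.Ioi 0)) := by
    refine tendsto_nhdsWithin_iff.2 ⟨?_, ?_⟩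
    · rw [neg_div]
      exact (tendsto_rpow_neg_atTop (by norm_num)).comp tendsto_natCast_atTop_atTop
    · filter_upwards [Filter.eventually_gt_atTop 0] with n hn
      exact Real.rpow_pos_of_pos (by exact_mod_cast hn) _
  have hlim : Filter.Tendsto
      (fun n : ℕ => (n : ℂ) * (phiNu ν (((n : ℝ) ^ (-(2 : ℝ) / 3)) * θ) - 1)) Filter.atTop
      (nhds (-((Real.sqrt ((1 + r) / 2) * Lnu r ν * |θ| ^ ((1 : ℝ) / 2) : ℝ) : ℂ) *
          (((|θ| : ℝ) : ℂ) - Complex.I * (θ : ℂ)))) := by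
    refine ((tendsto_phiNu_sub_one hr hprob hcrit hfin θ).comp hε).congr' ?_
    filter_upwards [Filter.eventually_gt_atTop 0] with n hn
    have hn' : (0 : ℝ) < n := by exact_mod_cast hn
    have h : (Real.sqrt ((n : ℝ) ^ (-(2 : ℝ) / 3)))⁻¹ * ((n : ℝ) ^ (-(2 : ℝ) / 3))⁻¹ = n := by
      rw [Real.sqrt_eq_rpow, ← Real.rpow_mul hn'.le, ← Real.rpow_neg hn'.le,
        ← Real.rpow_neg hn'.le, ← Real.rpow_add hn']
      norm_num
    rw [Function.comp_apply, ← Complex.ofReal_inv, ← Complex.ofReal_inv, ← Complex.ofReal_mul, h,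
      Complex.ofReal_natCast]
  have hpow := tendsto_pow_floor_mul hlim ht
  have hval : (t : ℂ) * (-((Real.sqrt ((1 + r) / 2) * Lnu r ν * |θ| ^ ((1 : ℝ) / 2) : ℝ) : ℂ) *
          (((|θ| : ℝ) : ℂ) - Complex.I * (θ : ℂ)))
      = -(((t * Real.sqrt ((1 + r) / 2) * Lnu r ν * |θ| ^ ((1 : ℝ) / 2) : ℝ)) : ℂ) *
          (((|θ| : ℝ) : ℂ) - Complex.I * (θ : ℂ)) := by
    push_cast
    ring
  rw [hval] at hpow
  refine ⟨hpow.congr fun n => ?_, hpow⟩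
  rw [← integral_exp_sum_eq_phiNu_pow hprob hmeas hindep hlaw]
  refine integral_congr_ae (Filter.Eventually.of_forall fun ω => ?_)
  simp only
  congr 1
  push_cast
  ring
end
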